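/- Let h = 692, let H be a finite simple chordal graph on n ≥ 2 vertices having neither K_4 nor K_{2,3} as a minor (i.e., H is chordal outerplanar), let v_n be a distinguished vertex of H, let q ≤ h − 2 = 690 be a nonnegative integer, and let c_0, c_1, …, c_q be a prescribed sequence of colors for v_n with c_i ≠ c_{i+1} for each i. Then for every pair of proper 5-colorings α' and β' of H with α'(v_n) = c_0 and β'(v_n) = c_q, there exists a transformation from α' to β' in which each vertex is recolored at most h times and v_n follows the prescribed coloring order c_0, …, c_q. -/

import Mathlib

open SimpleGraph

/-- A proper coloring of `G` with `ℓ` colors: adjacent vertices get distinct colors. -/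
def IsProperColoring {V : Type} (G : SimpleGraph V) {ℓ : ℕ} (c : V → Fin ℓ) : Prop :=
  ∀ ⦃u v : V⦄, G.Adj u v → c u ≠ c v

/-- `c` is a transformation sequence from `α` to `β`: a sequence of proper colorings
starting at `α`, ending at `β`, in which consecutive colorings differ on exactly one vertex. -/
def IsTransformSeq {V : Type} (G : SimpleGraph V) {ℓ m : ℕ}
    (c : Fin (m + 1) → V → Fin ℓ) (α β : V → Fin ℓ) : Prop :=
  c 0 = α ∧ c (Fin.last m) = β ∧ (∀ i, IsProperColoring G (c i)) ∧
    ∀ i : Fin m, ∃! v : V, c i.castSucc v ≠ c i.succ v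

/-- The number of steps of the sequence `c` at which the vertex `v` is recolored. -/
def RecolorCount {V : Type} {ℓ m : ℕ} (c : Fin (m + 1) → V → Fin ℓ) (v : V) : ℕ :=
  (Finset.univ.filter fun i : Fin m => c i.castSucc v ≠ c i.succ v).card

/-- `H` is a minor of `G`: there are pairwise disjoint nonempty branch sets in `G`, each
inducing a connected subgraph, with an edge of `G` between the branch sets of any two
vertices adjacent in `H`. -/
def IsMinor {W V : Type} (H : SimpleGraph W) (G : SimpleGraph V) : Prop :=
  ∃ B : W → Set V,
    (∀ h, (B h).Nonempty) ∧
    (Pairwise fun h h' => Disjoint (B h) (B h')) ∧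
    (∀ h, (G.induce (B h)).Connected) ∧
    ∀ ⦃h h'⦄, H.Adj h h' → ∃ u ∈ B h, ∃ v ∈ B h', G.Adj u v

/-- Every edge of `G` lies on at most one cycle: two cycles sharing an edge have the
same edge set. -/
def EdgeOnAtMostOneCycle {V : Type} (G : SimpleGraph V) : Prop :=
  ∀ (u v : V) (p : G.Walk u u) (q : G.Walk v v), p.IsCycle → q.IsCycle →
    ∀ e, e ∈ p.edges → e ∈ q.edges → ∀ e', (e' ∈ p.edges ↔ e' ∈ q.edges)

/-- A cactus graph: connected and every edge lies on at most one cycle. -/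
def IsCactus {V : Type} (G : SimpleGraph V) : Prop :=
  G.Connected ∧ EdgeOnAtMostOneCycle G

/-- A chordal graph: every cycle of length at least `4` has a chord; equivalently,
there is no induced cycle of length at least `4`. -/
def IsChordal {V : Type} (G : SimpleGraph V) : Prop :=
  ∀ (v : V) (p : G.Walk v v), p.IsCycle → 4 ≤ p.length →
    ∃ u w, u ∈ p.support ∧ w ∈ p.support ∧ G.Adj u w ∧ s(u, w) ∉ p.edges

/-- The sequence of successive colors taken by the vertex `v` along the sequence `c`
(its starting color followed by the new color at each of its recolorings). -/
def ColorTrace {V : Type} {ℓ m : ℕ} (c : Fin (m + 1) → V → Fin ℓ) (v : V) : List (Fin ℓ) :=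
  (List.ofFn fun i : Fin (m + 1) => c i v).destutter (· ≠ ·)

lemma eq_or_eq_of_five_colors : ∀ a b c d e : Fin 5, [a, b, c, d, e].Nodup →
    ∀ g, g ≠ c → g ≠ e → g ≠ d → g = a ∨ g = b := by decide

noncomputable section

open scoped Classical
open Function

variable {V : Type}

/-- The recoloring of `vertex` from the color `old` to the color `new`. -/
structure Move (V : Type) where
  vertex : V
  old : Fin 5
  new : Fin 5

namespace Recolor

/-- The coloring reached from `σ` after the moves `L`. -/
def run (σ : V → Fin 5) : List (Move V) → V → Fin 5
  | [] => σ
  | m :: L => run (update σ m.vertex m.new) L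

/-- The moves of `L` on vertices of `s`. -/
def restrict (s : Set V) (L : List (Move V)) : List (Move V) :=
  L.filter fun m => m.vertex ∈ s

/-- The number of moves of `v` in `L`. -/
def count (v : V) (L : List (Move V)) : ℕ := (restrict {v} L).length

/-- Starting from `σ`, every move of `L` starts at the current color of its vertex, changes it,
and creates no conflict with a neighbor in `s`. -/
def ValidOn (G : SimpleGraph V) (s : Set V) : (V → Fin 5) → List (Move V) → Prop
  | _, [] => True
  | σ, m :: L => σ m.vertex = m.old ∧ m.new ≠ m.old ∧ (∀ u ∈ s, G.Adj m.vertex u → σ u ≠ m.new) ∧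
      ValidOn G s (update σ m.vertex m.new) L

/-- The number of useful moves of `L`, where a move is useless if its new color is the one vacated
by the previous move; `o` is the color vacated just before `L`. -/
def useful : Option (Fin 5) → List (Move V) → ℕ
  | _, [] => 0
  | o, m :: L => (if o = some m.new then 0 else 1) + useful (some m.old) L

/-- The color vacated last, where `o` is the color vacated just before `L`. -/
def lastOld : Option (Fin 5) → List (Move V) → Option (Fin 5)
  | o, [] => o
  | _, m :: L => lastOld (some m.old) L

section Basic

variable {G : SimpleGraph V} {s t : Set V} {σ τ : V → Fin 5} {L M : List (Move V)} {m : Move V}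
  {v x : V} {o : Option (Fin 5)} {d : Fin 5}

@[simp] lemma run_nil : run σ [] = σ := rfl
@[simp] lemma run_cons : run σ (m :: L) = run (update σ m.vertex m.new) L := rfl

lemma run_append (σ : V → Fin 5) (L M : List (Move V)) : run σ (L ++ M) = run (run σ L) M := by
  induction L generalizing σ with
  | nil => rfl
  | cons m L ih => simp [ih]

@[simp] lemma restrict_nil : restrict s [] = [] := rfl

lemma restrict_cons_mem (h : m.vertex ∈ s) : restrict s (m :: L) = m :: restrict s L := by
  simp [restrict, h]

lemma restrict_cons_not_mem (h : m.vertex ∉ s) : restrict s (m :: L) = restrict s L := by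
  simp [restrict, h]

lemma restrict_append (s : Set V) (L M : List (Move V)) :
    restrict s (L ++ M) = restrict s L ++ restrict s M := by simp [restrict]

lemma restrict_restrict (h : s ⊆ t) (L : List (Move V)) :
    restrict s (restrict t L) = restrict s L := by
  simp only [restrict, List.filter_filter]
  refine List.filter_congr fun m _ => ?_
  by_cases hm : m.vertex ∈ s
  · simp [hm, h hm]
  · simp [hm]

lemma restrict_congr (h : ∀ m ∈ L, (m.vertex ∈ s ↔ m.vertex ∈ t)) :
    restrict s L = restrict t L :=
  List.filter_congr fun m hm => by simp [h m hm]

lemma restrict_eq_self (h : ∀ m ∈ L, m.vertex ∈ s) : restrict s L = L := by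
  simpa [restrict] using h

lemma restrict_eq_nil (h : ∀ m ∈ L, m.vertex ∉ s) : restrict s L = [] := by
  simpa [restrict] using h

@[simp] lemma count_nil : count v [] = 0 := rfl

lemma count_cons_self (h : m.vertex = v) : count v (m :: L) = count v L + 1 := by
  simp [count, restrict, h]

lemma count_cons_of_ne (h : m.vertex ≠ v) : count v (m :: L) = count v L := by
  simp [count, restrict, h]

lemma count_append (v : V) (L M : List (Move V)) :
    count v (L ++ M) = count v L + count v M := by simp [count, restrict_append]

lemma count_restrict (h : v ∈ s) (L : List (Move V)) : count v (restrict s L) = count v L := by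
  rw [count, restrict_restrict (by simpa using h), count]

lemma validOn_append : ValidOn G s σ (L ++ M) ↔ ValidOn G s σ L ∧ ValidOn G s (run σ L) M := by
  induction L generalizing σ with
  | nil => simp [ValidOn]
  | cons m L ih => simp [ValidOn, ih, and_assoc]

lemma ValidOn.restrict (h : ValidOn G s σ L) (hts : t ⊆ s) (hτ : ∀ v ∈ t, τ v = σ v) :
    ValidOn G t τ (restrict t L) := by
  induction L generalizing σ τ with
  | nil => trivial
  | cons m L ih =>
    obtain ⟨h1, h2, h3, h4⟩ := h
    by_cases hm : m.vertex ∈ t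
    · rw [restrict_cons_mem hm]
      refine ⟨(hτ _ hm).trans h1, h2, fun u hu hadj => by rw [hτ u hu]; exact h3 u (hts hu) hadj,
        ih h4 fun v hv => ?_⟩
      by_cases hvm : v = m.vertex
      · simp [hvm]
      · simp [hvm, hτ v hv]
    · rw [restrict_cons_not_mem hm]
      refine ih h4 fun v hv => ?_
      rw [hτ v hv, update_of_ne]
      rintro rfl
      exact hm hv

lemma run_restrict (hτ : ∀ v ∈ t, τ v = σ v) (hv : v ∈ t) :
    run τ (restrict t L) v = run σ L v := by
  induction L generalizing σ τ with
  | nil => exact hτ v hv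
  | cons m L ih =>
    by_cases hm : m.vertex ∈ t
    · rw [restrict_cons_mem hm]
      refine ih fun u hu => ?_
      by_cases hum : u = m.vertex
      · simp [hum]
      · simp [hum, hτ u hu]
    · rw [restrict_cons_not_mem hm]
      refine ih fun u hu => ?_
      rw [hτ u hu, update_of_ne]
      rintro rfl
      exact hm hu

lemma run_of_not_mem (h : ∀ m ∈ L, m.vertex ≠ v) : run σ L v = σ v := by
  rw [← run_restrict (t := {v}) (τ := σ) (fun _ _ => rfl) rfl, restrict_eq_nil (by simpa using h)]
  rfl

lemma validOn_union {σ₁ σ₂ : V → Fin 5} (hs : ValidOn G s σ₁ (restrict s L))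
    (ht : ValidOn G t σ₂ (restrict t L)) (h1 : ∀ v ∈ s, σ₁ v = σ v) (h2 : ∀ v ∈ t, σ₂ v = σ v)
    (hL : ∀ m ∈ L, m.vertex ∈ s ∪ t)
    (hadj : ∀ u ∈ s ∪ t, ∀ v ∈ s ∪ t, G.Adj u v → (u ∈ s ∧ v ∈ s) ∨ (u ∈ t ∧ v ∈ t)) :
    ValidOn G (s ∪ t) σ L := by
  induction L generalizing σ σ₁ σ₂ with
  | nil => trivial
  | cons m L ih =>
    have upd : ∀ (r : Set V) (ρ : V → Fin 5), ValidOn G r ρ (Recolor.restrict r (m :: L)) →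
        (∀ v ∈ r, ρ v = σ v) →
        (m.vertex ∈ r → σ m.vertex = m.old ∧ m.new ≠ m.old ∧
          ∀ u ∈ r, G.Adj m.vertex u → σ u ≠ m.new) ∧
        ∃ ρ', ValidOn G r ρ' (Recolor.restrict r L) ∧
          ∀ v ∈ r, ρ' v = update σ m.vertex m.new v := by
      intro r ρ hr hρ
      by_cases hm : m.vertex ∈ r
      · rw [restrict_cons_mem hm] at hr
        obtain ⟨a1, a2, a3, a4⟩ := hr
        refine ⟨fun _ => ⟨(hρ _ hm).symm.trans a1, a2, fun u hu h => hρ u hu ▸ a3 u hu h⟩,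
          _, a4, fun v hv => ?_⟩
        by_cases hvm : v = m.vertex
        · simp [hvm]
        · simp [hvm, hρ v hv]
      · rw [restrict_cons_not_mem hm] at hr
        refine ⟨fun h => absurd h hm, ρ, hr, fun v hv => ?_⟩
        rw [hρ v hv, update_of_ne]
        rintro rfl
        exact hm hv
    obtain ⟨as, ρ₁, v1, e1⟩ := upd s σ₁ hs h1
    obtain ⟨at', ρ₂, v2, e2⟩ := upd t σ₂ ht h2
    have hm : m.vertex ∈ s ∪ t := hL m (by simp)
    refine ⟨?_, ?_, fun u hu h => ?_, ih v1 v2 e1 e2 fun m' hm' => hL m' (by simp [hm'])⟩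
    · exact hm.elim (fun h => (as h).1) fun h => (at' h).1
    · exact hm.elim (fun h => (as h).2.1) fun h => (at' h).2.1
    · obtain ⟨ha, hb⟩ | ⟨ha, hb⟩ := hadj _ hm u hu h
      · exact (as ha).2.2 u hb h
      · exact (at' ha).2.2 u hb h

/-- Two move sequences agreeing on the common part of their vertex sets have a common shuffle. -/
lemma exists_shuffle (hL : ∀ m ∈ L, m.vertex ∈ s) (hM : ∀ m ∈ M, m.vertex ∈ t)
    (h : restrict t L = restrict s M) :
    ∃ K, restrict s K = L ∧ restrict t K = M ∧ ∀ m ∈ K, m.vertex ∈ s ∪ t := by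
  induction L generalizing M with
  | nil => exact ⟨M, h.symm, restrict_eq_self hM, fun m hm => Or.inr (hM m hm)⟩
  | cons l L ihL =>
    have hl := hL l (by simp)
    have hL' : ∀ m ∈ L, m.vertex ∈ s := fun m hm => hL m (by simp [hm])
    by_cases hlt : l.vertex ∈ t
    · induction M with
      | nil => simp [restrict_cons_mem hlt] at h
      | cons m M ihM =>
        have hm := hM m (by simp)
        have hM' : ∀ m ∈ M, m.vertex ∈ t := fun m hm => hM m (by simp [hm])
        by_cases hms : m.vertex ∈ s
        · rw [restrict_cons_mem hlt, restrict_cons_mem hms, List.cons.injEq] at h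
          obtain ⟨rfl, h⟩ := h
          obtain ⟨K, hK1, hK2, hK3⟩ := ihL hL' hM' h
          refine ⟨l :: K, by rw [restrict_cons_mem hl, hK1], by rw [restrict_cons_mem hlt, hK2], ?_⟩
          simpa [hl] using hK3
        · rw [restrict_cons_not_mem hms] at h
          obtain ⟨K, hK1, hK2, hK3⟩ := ihM hM' h
          refine ⟨m :: K, by rw [restrict_cons_not_mem hms, hK1],
            by rw [restrict_cons_mem hm, hK2], ?_⟩
          simpa [hm] using hK3
    · rw [restrict_cons_not_mem hlt] at h
      obtain ⟨K, hK1, hK2, hK3⟩ := ihL hL' hM h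
      refine ⟨l :: K, by rw [restrict_cons_mem hl, hK1], by rw [restrict_cons_not_mem hlt, hK2], ?_⟩
      simpa [hl] using hK3

lemma useful_append (o : Option (Fin 5)) (L M : List (Move V)) :
    useful o (L ++ M) = useful o L + useful (lastOld o L) M := by
  induction L generalizing o with
  | nil => simp [useful, lastOld]
  | cons m L ih => simp [useful, lastOld, ih, add_assoc]

lemma useful_le_none (o : Option (Fin 5)) (L : List (Move V)) : useful o L ≤ useful none L := by
  cases L with
  | nil => rfl
  | cons m L => simp only [useful]; split_ifs <;> simp_all

lemma useful_le_length (o : Option (Fin 5)) (L : List (Move V)) : useful o L ≤ L.length := by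
  induction L generalizing o with
  | nil => simp [useful]
  | cons m L ih =>
    have := ih (some m.old)
    simp only [useful, List.length_cons]
    split_ifs <;> omega

lemma useful_none_append_le (L M : List (Move V)) :
    useful none (L ++ M) ≤ useful none L + useful none M := by
  rw [useful_append]
  gcongr
  exact useful_le_none _ _

/-- A color that is neither present on `s` nor taken during `L` is not vacated during `L`. -/
lemma ValidOn.old_ne (h : ValidOn G s σ L) (hL : ∀ m ∈ L, m.vertex ∈ s) (hd : ∀ v ∈ s, σ v ≠ d)
    (hnew : ∀ m ∈ L, m.new ≠ d) : ∀ m ∈ L, m.old ≠ d := by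
  induction L generalizing σ with
  | nil => simp
  | cons m L ih =>
    obtain ⟨h1, -, -, h4⟩ := h
    simp only [List.forall_mem_cons] at hL hnew ⊢
    refine ⟨h1 ▸ hd _ hL.1, ih h4 hL.2 (fun v hv => ?_) hnew.2⟩
    by_cases hvm : v = m.vertex
    · subst hvm; simpa using hnew.1
    · simpa [hvm] using hd v hv

lemma lastOld_ne (ho : o ≠ some d) (h : ∀ m ∈ L, m.old ≠ d) : lastOld o L ≠ some d := by
  induction L generalizing o with
  | nil => exact ho
  | cons m L ih =>
    simp only [List.forall_mem_cons] at h
    exact ih (by simpa using h.1) h.2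

lemma exists_first (h : ∃ m ∈ L, m.new = d) :
    ∃ L₁ m L₂, L = L₁ ++ m :: L₂ ∧ m.new = d ∧ ∀ m ∈ L₁, m.new ≠ d := by
  induction L with
  | nil => simp at h
  | cons l L ih =>
    by_cases hl : l.new = d
    · exact ⟨[], l, L, rfl, hl, by simp⟩
    · obtain ⟨L₁, m, L₂, rfl, hm, hL₁⟩ := ih (by simpa [hl] using h)
      exact ⟨l :: L₁, m, L₂, rfl, hm, by simpa [hl] using hL₁⟩

lemma one_le_useful (h : ValidOn G s σ L) (hL : ∀ m ∈ L, m.vertex ∈ s) (hd : ∀ v ∈ s, σ v ≠ d)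
    (ho : o ≠ some d) (hmem : ∃ m ∈ L, m.new = d) : 1 ≤ useful o L := by
  obtain ⟨L₁, m, L₂, rfl, hm, hL₁⟩ := exists_first hmem
  have := lastOld_ne ho
    ((validOn_append.1 h).1.old_ne (fun m hm => hL m (by simp [hm])) hd hL₁)
  rw [useful_append, useful, hm, if_neg this]
  omega

/-- Moves avoiding the color of a fixed vertex `x` stay valid when `x` is taken into account. -/
lemma ValidOn.insert (h : ValidOn G s σ L) (hx : ∀ m ∈ L, m.vertex ≠ x)
    (hnew : ∀ m ∈ L, m.new ≠ σ x) : ValidOn G (insert x s) σ L := by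
  induction L generalizing σ with
  | nil => trivial
  | cons m L ih =>
    obtain ⟨h1, h2, h3, h4⟩ := h
    simp only [List.forall_mem_cons] at hx hnew
    refine ⟨h1, h2, ?_, ih h4 hx.2 ?_⟩
    · rintro u (rfl | hu) hadj
      · exact hnew.1.symm
      · exact h3 u hu hadj
    · rw [update_of_ne hx.1.symm]
      exact hnew.2

lemma ValidOn.congr (h : ValidOn G s σ L) (hL : ∀ m ∈ L, m.vertex ∈ s)
    (hτ : ∀ v ∈ s, τ v = σ v) : ValidOn G s τ L := by
  simpa [restrict_eq_self hL] using h.restrict subset_rfl hτ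

end Basic

section Triangle

variable {G : SimpleGraph V} {p w x : V} {σ : V → Fin 5} {L M R S : List (Move V)} {m : Move V}
  {o : Option (Fin 5)} {b c d e : Fin 5} {C C' D D' : ℕ}

/-- The linear bound on the useful moves of the pair `w, x` obtained when recoloring a vertex `x`
adjacent to `p` and `w`. -/
def Cheap (p w x : V) (C : ℕ) (L : List (Move V)) : Prop :=
  4 * useful none (restrict {w, x} L) + 3 * count x L ≤ 6 * count w L + 4 * count p L + C

/-- The moves `M` of `p` and `w` can be completed with few moves of `x` so that `x` ends with
color `b`. -/
def Extends (G : SimpleGraph V) (p w x : V) (b : Fin 5) (C D : ℕ) (σ : V → Fin 5)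
    (o : Option (Fin 5)) (M : List (Move V)) : Prop :=
  ∃ L, restrict {x}ᶜ L = M ∧ ValidOn G (insert x {p, w}) σ L ∧ run σ L x = b ∧
    Cheap p w x C L ∧ Cheap w p x C L ∧ 2 * count x L ≤ useful o M + D

lemma Extends.symm (h : Extends G p w x b C D σ o M) : Extends G w p x b C D σ o M := by
  obtain ⟨L, h1, h2, h3, h4, h5, h6⟩ := h
  exact ⟨L, h1, by rwa [Set.pair_comm], h3, h5, h4, h6⟩

lemma Extends.mono (h : Extends G p w x b C D σ o M) (hC : C ≤ C') (hD : D ≤ D') :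
    Extends G p w x b C' D' σ o M := by
  obtain ⟨L, h1, h2, h3, h4, h5, h6⟩ := h
  unfold Cheap at h4 h5
  exact ⟨L, h1, h2, h3, by unfold Cheap; omega, by unfold Cheap; omega, by omega⟩

lemma Extends.prepend {o' : Option (Fin 5)} (h : Extends G p w x b C D (run σ L) o' R)
    (hL : restrict {x}ᶜ L = M) (hv : ValidOn G (insert x {p, w}) σ L)
    (hp : 4 * useful none (restrict {w, x} L) + 3 * count x L + C ≤
      6 * count w L + 4 * count p L + C')
    (hw : 4 * useful none (restrict {p, x} L) + 3 * count x L + C ≤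
      6 * count p L + 4 * count w L + C')
    (hu : 2 * count x L + useful o' R + D ≤ useful o (M ++ R) + D') :
    Extends G p w x b C' D' σ o (M ++ R) := by
  obtain ⟨L', h1, h2, h3, h4, h5, h6⟩ := h
  have u1 := useful_none_append_le (restrict {w, x} L) (restrict {w, x} L')
  have u2 := useful_none_append_le (restrict {p, x} L) (restrict {p, x} L')
  unfold Cheap at h4 h5
  refine ⟨L ++ L', by rw [restrict_append, hL, h1], validOn_append.2 ⟨hv, h2⟩,
    by rwa [run_append], ?_, ?_, ?_⟩
  · unfold Cheap; rw [restrict_append]; simp only [count_append]; omega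
  · unfold Cheap; rw [restrict_append]; simp only [count_append]; omega
  · rw [count_append]; omega

/-- Among the two colors avoiding three given ones, one occurs in `R` either never or only after
the other one. -/
lemma exists_late_color (a b c : Fin 5) (R : List (Move V)) :
    ∃ d e : Fin 5, (d ≠ a ∧ d ≠ b ∧ d ≠ c) ∧ (e ≠ a ∧ e ≠ b ∧ e ≠ c) ∧ d ≠ e ∧
      ((∀ m ∈ R, m.new ≠ d) ∨ ∃ S m R', R = S ++ m :: R' ∧ m.new = d ∧ (∀ m ∈ S, m.new ≠ d) ∧
        ∃ m ∈ S, m.new = e) := by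
  have key : ∀ a b c : Fin 5, ∃ d e : Fin 5, (d ≠ a ∧ d ≠ b ∧ d ≠ c) ∧
      (e ≠ a ∧ e ≠ b ∧ e ≠ c) ∧ d ≠ e := by decide
  obtain ⟨d, e, hd, he, hde⟩ := key a b c
  by_cases h : ∃ m ∈ R, m.new = d
  · obtain ⟨S, m, R', rfl, hm, hS⟩ := exists_first h
    by_cases heS : ∃ m ∈ S, m.new = e
    · exact ⟨d, e, hd, he, hde, Or.inr ⟨S, m, R', rfl, hm, hS, heS⟩⟩
    · push Not at heS
      refine ⟨e, d, he, hd, hde.symm, ?_⟩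
      by_cases heR : ∃ m ∈ R', m.new = e
      · obtain ⟨S', m', R'', rfl, hm', hS'⟩ := exists_first heR
        refine Or.inr ⟨S ++ m :: S', m', R'', by simp, hm', ?_, m, by simp, hm⟩
        simp only [List.forall_mem_append, List.forall_mem_cons]
        exact ⟨heS, hm ▸ hde, hS'⟩
      · push Not at heR
        refine Or.inl ?_
        simp only [List.forall_mem_append, List.forall_mem_cons]
        exact ⟨heS, hm ▸ hde, heR⟩
  · push Not at h
    exact ⟨d, e, hd, he, hde, Or.inl h⟩

lemma length_restrict_pair_le (hx : ∀ m ∈ L, m.vertex ≠ x) :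
    (restrict {w, x} L).length = count w L := by
  rw [count, restrict_congr (t := {w})]
  intro m hm
  simp [hx m hm]

lemma useful_pair_le (hx : ∀ m ∈ L, m.vertex ≠ x) (o : Option (Fin 5)) :
    useful o (restrict {w, x} L) ≤ count w L :=
  (useful_le_length _ _).trans (length_restrict_pair_le hx).le

lemma count_eq_zero (hx : ∀ m ∈ L, m.vertex ≠ x) : count x L = 0 := by
  rw [count, restrict_eq_nil (by simpa using hx)]
  rfl

/-- If the current color of `x` is never taken by `p` or `w`, then one final move suffices. -/
lemma extends_of_avoid (hxp : G.Adj x p) (hxw : G.Adj x w)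
    (hM : ∀ m ∈ M, m.vertex ∈ ({p, w} : Set V)) (h : ValidOn G {p, w} σ M)
    (havoid : ∀ m ∈ M, m.new ≠ σ x) (hbp : run σ M p ≠ b) (hbw : run σ M w ≠ b) :
    Extends G p w x b 7 2 σ o M := by
  have hMx : ∀ m ∈ M, m.vertex ≠ x := by
    intro m hm hmx
    have := hM m hm
    simp [hmx, hxp.ne, hxw.ne] at this
  have hrun : run σ M x = σ x := run_of_not_mem hMx
  have hMr : restrict {x}ᶜ M = M := restrict_eq_self (by simpa using hMx)
  have hval := h.insert hMx havoid
  have c0 := count_eq_zero hMx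
  have u1 := useful_pair_le (w := w) hMx none
  have u2 := useful_pair_le (w := p) hMx none
  by_cases hb : σ x = b
  · refine ⟨M, hMr, hval, hrun.trans hb, ?_, ?_, by omega⟩
    · unfold Cheap; omega
    · unfold Cheap; omega
  · have c1 : count x [(⟨x, σ x, b⟩ : Move V)] = 1 := by simp [count_cons_self]
    have cp : count p [(⟨x, σ x, b⟩ : Move V)] = 0 := by simp [count_cons_of_ne, hxp.ne]
    have cw : count w [(⟨x, σ x, b⟩ : Move V)] = 0 := by simp [count_cons_of_ne, hxw.ne]
    have ul : ∀ r : Set V, useful none (restrict r [(⟨x, σ x, b⟩ : Move V)]) ≤ 1 := fun r =>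
      (useful_le_length _ _).trans (List.length_filter_le _ _)
    refine ⟨M ++ [⟨x, σ x, b⟩], ?_, validOn_append.2 ⟨hval, hrun, Ne.symm hb, ?_, trivial⟩,
      by simp [run_append], ?_, ?_, ?_⟩
    · rw [restrict_append, hMr, restrict_cons_not_mem (by simp)]
      simp
    · rintro u (rfl | rfl | rfl) hadj
      · exact absurd hadj G.irrefl
      · exact hbp
      · exact hbw
    · have := useful_none_append_le (restrict {w, x} M) (restrict {w, x} [⟨x, σ x, b⟩])
      have := ul {w, x}
      unfold Cheap; rw [restrict_append]; simp only [count_append]; omega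
    · have := useful_none_append_le (restrict {p, x} M) (restrict {p, x} [⟨x, σ x, b⟩])
      have := ul {p, x}
      unfold Cheap; rw [restrict_append]; simp only [count_append]; omega
    · rw [count_append]; omega

/-- `m :: S` consists of a move of `p` followed by a move of `w`. -/
def IsTight (p w : V) (m : Move V) (S : List (Move V)) : Prop :=
  m.vertex = p ∧ ∃ y, S = [y] ∧ y.vertex = w

lemma count_segment (hxp : G.Adj x p) (hxw : G.Adj x w)
    (hmv : m.vertex ∈ ({p, w} : Set V))
    (hS : ∀ m ∈ S, m.vertex ∈ ({p, w} : Set V)) :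
    count x (⟨x, m.new, d⟩ :: m :: S) = 1 := by
  have hmx : ∀ m' ∈ m :: S, m'.vertex ≠ x := by
    intro m' hm' hmx
    have : m'.vertex ∈ ({p, w} : Set V) := by
      rcases List.mem_cons.1 hm' with rfl | h
      · exact hmv
      · exact hS _ h
    simp [hmx, hxp.ne, hxw.ne] at this
  rw [count_cons_self (by rfl), count_eq_zero hmx]

lemma segment_cost (hxp : G.Adj x p) (hxw : G.Adj x w) (hpw : p ≠ w)
    (hmv : m.vertex ∈ ({p, w} : Set V))
    (hS : ∀ m ∈ S, m.vertex ∈ ({p, w} : Set V)) (hne : S ≠ []) :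
    Cheap p w x 1 (⟨x, m.new, d⟩ :: m :: S) ∧ (¬ IsTight p w m S →
      4 * useful none (restrict {w, x} (⟨x, m.new, d⟩ :: m :: S)) +
          3 * count x (⟨x, m.new, d⟩ :: m :: S) + 1 ≤
        6 * count w (⟨x, m.new, d⟩ :: m :: S) + 4 * count p (⟨x, m.new, d⟩ :: m :: S)) := by
  have hSx : ∀ m ∈ S, m.vertex ≠ x := by
    intro m hm hmx
    have := hS m hm
    simp [hmx, hxp.ne, hxw.ne] at this
  have hsum : count p S + count w S = S.length := by
    clear hne hSx
    induction S with
    | nil => rfl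
    | cons y S ih =>
      simp only [List.forall_mem_cons] at hS
      have := ih hS.2
      obtain h | h := hS.1
      · rw [count_cons_self h, count_cons_of_ne (by rw [h]; exact hpw)]
        simp only [List.length_cons]; omega
      · rw [count_cons_self h, count_cons_of_ne (by rw [h]; exact hpw.symm)]
        simp only [List.length_cons]; omega
  have hlen : 1 ≤ S.length := List.length_pos_iff.2 hne
  have cx := count_segment (d := d) hxp hxw hmv hS
  have hp1 : count p (⟨x, m.new, d⟩ :: m :: S) = count p (m :: S) := count_cons_of_ne hxp.ne
  have hw1 : count w (⟨x, m.new, d⟩ :: m :: S) = count w (m :: S) := count_cons_of_ne hxw.ne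
  have u0 : useful none (restrict {w, x} (⟨x, m.new, d⟩ :: m :: S)) =
      1 + useful (some m.new) (restrict {w, x} (m :: S)) := by
    rw [restrict_cons_mem (by simp)]
    simp [useful]
  unfold Cheap
  rw [cx, hp1, hw1, u0]
  obtain h | h := hmv
  · have hmw : m.vertex ≠ w := h ▸ hpw
    rw [count_cons_self h, count_cons_of_ne hmw,
      restrict_cons_not_mem (by simp [h, hpw, hxp.ne.symm])]
    have u1 := useful_pair_le (w := w) hSx (some m.new)
    refine ⟨by omega, fun ht => ?_⟩
    by_cases h1 : S.length = 1 ∧ count w S = 1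
    · obtain ⟨y, rfl⟩ := List.length_eq_one_iff.1 h1.1
      refine absurd ⟨h, y, rfl, ?_⟩ ht
      by_contra hy
      rw [count_cons_of_ne hy] at h1
      simp at h1
    · omega
  · have hmp : m.vertex ≠ p := h ▸ hpw.symm
    have u1 := useful_pair_le (w := w) hSx (some m.old)
    rw [count_cons_self h, count_cons_of_ne hmp, restrict_cons_mem (by left; exact h)]
    simp only [useful, if_true]
    exact ⟨by omega, fun _ => by omega⟩

lemma validOn_segment (hx : σ x = m.new) (hmS : ∀ m' ∈ m :: S, m'.vertex ∈ ({p, w} : Set V))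
    (hxp : G.Adj x p) (hxw : G.Adj x w) (h : ValidOn G {p, w} σ (m :: S))
    (hd : d ≠ σ p ∧ d ≠ σ w ∧ d ≠ m.new) (hS : ∀ m' ∈ S, m'.new ≠ d) :
    ValidOn G (insert x {p, w}) σ (⟨x, m.new, d⟩ :: m :: S) := by
  have hmx : ∀ m' ∈ m :: S, m'.vertex ≠ x := by
    intro m' hm' hmx
    have := hmS m' hm'
    simp [hmx, hxp.ne, hxw.ne] at this
  refine ⟨hx, hd.2.2, ?_, ?_⟩
  · rintro u (rfl | rfl | rfl) hadj
    · exact absurd hadj G.irrefl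
    · exact hd.1.symm
    · exact hd.2.1.symm
  · refine (h.congr (τ := update σ x d) hmS ?_).insert hmx ?_
    · rintro v (rfl | rfl)
      · simp [hxp.ne.symm]
      · simp [hxw.ne.symm]
    · simp only [update_self, List.forall_mem_cons]
      exact ⟨hd.2.2.symm, hS⟩

lemma useful_segment (hmS : ∀ m' ∈ m :: S, m'.vertex ∈ ({p, w} : Set V))
    (h : ValidOn G {p, w} σ (m :: S)) (ho : o ≠ some m.new)
    (he : e ≠ σ p ∧ e ≠ σ w ∧ e ≠ m.new) (hS : ∃ m' ∈ S, m'.new = e) :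
    2 ≤ useful o (m :: S) := by
  obtain ⟨h1, -, -, h4⟩ := h
  simp only [List.forall_mem_cons] at hmS
  have := one_le_useful (o := some m.old) h4 hmS.2 (d := e) ?_ ?_ hS
  · simp only [useful, if_neg ho]; omega
  · intro v hv
    by_cases hvm : v = m.vertex
    · subst hvm; simpa using he.2.2.symm
    · rw [update_of_ne hvm]
      obtain rfl | rfl := hv
      exacts [he.1.symm, he.2.1.symm]
  · rw [← h1]
    obtain h | h := hmS.1 <;> rw [h] <;> simp [he.1.symm, he.2.1.symm]

lemma lastOld_segment_ne (hmS : ∀ m' ∈ m :: S, m'.vertex ∈ ({p, w} : Set V))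
    (h : ValidOn G {p, w} σ (m :: S)) (hd : d ≠ σ p ∧ d ≠ σ w ∧ d ≠ m.new)
    (hS : ∀ m' ∈ S, m'.new ≠ d) : lastOld o (m :: S) ≠ some d := by
  have : ∀ m' ∈ m :: S, m'.old ≠ d := h.old_ne hmS (by
    rintro v (rfl | rfl)
    exacts [hd.1.symm, hd.2.1.symm]) (by simpa using ⟨hd.2.2.symm, hS⟩)
  simp only [List.forall_mem_cons] at this
  change lastOld (some m.old) S ≠ some d
  exact lastOld_ne (by simpa using this.1) this.2

/-- Two tight segments in a row can be completed cheaply, if necessary by choosing the first new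
color of `x` differently. -/
lemma extends_of_tight {a b' f g : Fin 5} (hxp : G.Adj x p) (hxw : G.Adj x w) (hpw : p ≠ w)
    (hp : σ p = a) (hw : σ w = b') (hx : σ x = c)
    (hab : a ≠ b') (hac : a ≠ c) (hbc : b' ≠ c) (hd : d ≠ a ∧ d ≠ b' ∧ d ≠ c)
    (he : e ≠ a ∧ e ≠ b' ∧ e ≠ c) (hde : d ≠ e) (hfg : g = b' ∧ f = a ∨ g = a ∧ f = b')
    (ho : o ≠ some c)
    (h : Extends G p w x b C D (run σ [⟨x, c, d⟩, ⟨p, a, c⟩, ⟨w, b', e⟩, ⟨x, d, g⟩, ⟨p, c, d⟩,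
      ⟨w, e, f⟩]) (some e) R) :
    Extends G p w x b C D σ o ([⟨p, a, c⟩, ⟨w, b', e⟩, ⟨p, c, d⟩, ⟨w, e, f⟩] ++ R) := by
  have hpw' := hpw.symm
  have hxp1 := hxp.ne
  have hxw1 := hxw.ne
  have hxp2 := hxp.ne.symm
  have hxw2 := hxw.ne.symm
  obtain ⟨hd1, hd2, hd3⟩ := hd
  obtain ⟨he1, he2, he3⟩ := he
  have hu : useful o ([⟨p, a, c⟩, ⟨w, b', e⟩, ⟨p, c, d⟩, ⟨w, e, f⟩] ++ R) =
      4 + useful (some e) R := by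
    have hf : c ≠ f := by rcases hfg with ⟨-, rfl⟩ | ⟨-, rfl⟩ <;> [exact hac.symm; exact hbc.symm]
    simp [useful, ho, he1.symm, hd2.symm, hf]
    omega
  have hadj : ∀ (r : V) (P : V → Prop), r = x ∨ r = p ∨ r = w → (r ≠ x → P x) → (r ≠ p → P p) →
      (r ≠ w → P w) → ∀ u ∈ insert x ({p, w} : Set V), G.Adj r u → P u := by
    rintro r P - h1 h2 h3 u (rfl | rfl | rfl) hru
    exacts [h1 hru.ne, h2 hru.ne, h3 hru.ne]
  rcases hfg with ⟨rfl, rfl⟩ | ⟨rfl, rfl⟩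
  · refine h.prepend ?_ ?_ ?_ ?_ ?_
    · simp [restrict, *]
    · refine ⟨?_, ?_, hadj _ _ (by simp) ?_ ?_ ?_, ?_, ?_, hadj _ _ (by simp) ?_ ?_ ?_,
        ?_, ?_, hadj _ _ (by simp) ?_ ?_ ?_, ?_, ?_, hadj _ _ (by simp) ?_ ?_ ?_,
        ?_, ?_, hadj _ _ (by simp) ?_ ?_ ?_, ?_, ?_, hadj _ _ (by simp) ?_ ?_ ?_, trivial⟩ <;>
      simp [*] <;> grind
    · simp [restrict, count, useful, *]; grind
    · simp [restrict, count, useful, *]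
    · rw [hu]
      simp [restrict, count, *]
  · have hrun : run σ [⟨x, c, d⟩, ⟨p, g, c⟩, ⟨w, f, e⟩, ⟨x, d, g⟩, ⟨p, c, d⟩, ⟨w, e, f⟩] =
        run σ [⟨x, c, e⟩, ⟨p, g, c⟩, ⟨x, e, g⟩, ⟨w, f, e⟩, ⟨p, c, d⟩, ⟨w, e, f⟩] := by
      funext v
      simp only [run_cons, run_nil, update_apply]
      grind
    rw [hrun] at h
    refine h.prepend ?_ ?_ ?_ ?_ ?_
    · simp [restrict, *]
    · refine ⟨?_, ?_, hadj _ _ (by simp) ?_ ?_ ?_, ?_, ?_, hadj _ _ (by simp) ?_ ?_ ?_,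
        ?_, ?_, hadj _ _ (by simp) ?_ ?_ ?_, ?_, ?_, hadj _ _ (by simp) ?_ ?_ ?_,
        ?_, ?_, hadj _ _ (by simp) ?_ ?_ ?_, ?_, ?_, hadj _ _ (by simp) ?_ ?_ ?_, trivial⟩ <;>
      simp [*] <;> grind
    · simp [restrict, count, useful, *]; grind
    · simp [restrict, count, useful, *]; grind
    · rw [hu]
      simp [restrict, count, *]

lemma lastOld_append (o : Option (Fin 5)) (L M : List (Move V)) :
    lastOld o (L ++ M) = lastOld (lastOld o L) M := by
  induction L generalizing o with
  | nil => rfl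
  | cons m L ih => exact ih _

/-- The vertices `p` and `w` are about to make the moves `m :: R`, the first of which takes the
current color of `x`. -/
structure IsHit (G : SimpleGraph V) (p w x : V) (b : Fin 5) (σ : V → Fin 5) (o : Option (Fin 5))
    (m : Move V) (R : List (Move V)) : Prop where
  color : σ x = m.new
  mem : ∀ m' ∈ m :: R, m'.vertex ∈ ({p, w} : Set V)
  valid : ValidOn G {p, w} σ (m :: R)
  ne : σ p ≠ σ w
  left : run σ (m :: R) p ≠ b
  right : run σ (m :: R) w ≠ b
  prev : o ≠ some m.new

lemma IsHit.symm (h : IsHit G p w x b σ o m R) : IsHit G w p x b σ o m R :=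
  ⟨h.color, by rw [Set.pair_comm]; exact h.mem, by rw [Set.pair_comm]; exact h.valid, h.ne.symm,
    h.right, h.left, h.prev⟩

lemma ValidOn.run_ne (h : ValidOn G s σ L) {u v : V} (hu : u ∈ s) (hv : v ∈ s) (huv : G.Adj u v)
    (hσ : σ u ≠ σ v) : run σ L u ≠ run σ L v := by
  induction L generalizing σ with
  | nil => exact hσ
  | cons m L ih =>
    obtain ⟨-, -, h3, h4⟩ := h
    refine ih h4 ?_
    by_cases h1 : u = m.vertex
    · subst h1
      rw [update_self, update_of_ne huv.ne.symm]
      exact (h3 v hv huv).symm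
    · rw [update_of_ne h1]
      by_cases h2 : v = m.vertex
      · subst h2
        rw [update_self]
        exact h3 u hu huv.symm
      · rwa [update_of_ne h2]

lemma run_insert_eq (hx : ∀ m ∈ L, m.vertex ≠ x) {v : V} (hv : v ≠ x) :
    run (update σ x d) L v = run σ L v := by
  have h := run_restrict (σ := σ) (τ := update σ x d) (t := {x}ᶜ) (L := L)
    (fun v hv => update_of_ne hv _ _) hv
  rwa [restrict_eq_self hx] at h

lemma IsHit.ne_of_mem (h : IsHit G p w x b σ o m R) (hxp : G.Adj x p) (hxw : G.Adj x w) :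
    ∀ m' ∈ m :: R, m'.vertex ≠ x := by
  intro m' hm' hmx
  have := h.mem m' hm'
  simp [hmx, hxp.ne, hxw.ne] at this

lemma IsHit.next {m₂ : Move V} {R' : List (Move V)} (hxp : G.Adj x p) (hxw : G.Adj x w)
    (hpw : G.Adj p w) (h : IsHit G p w x b σ o m (S ++ m₂ :: R'))
    (hd : d ≠ σ p ∧ d ≠ σ w ∧ d ≠ m.new) (hS : ∀ m' ∈ S, m'.new ≠ d) (hm₂ : m₂.new = d) :
    IsHit G p w x b (run σ (⟨x, m.new, d⟩ :: m :: S)) (lastOld o (m :: S)) m₂ R' := by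
  have hne := h.ne_of_mem hxp hxw
  have hmem := h.mem
  have hval := h.valid
  have hl := h.left
  have hr := h.right
  rw [← List.cons_append, List.forall_mem_append] at hmem hne
  rw [← List.cons_append, validOn_append] at hval
  rw [← List.cons_append, run_append] at hl hr
  have hrun : ∀ v ≠ x, run σ (⟨x, m.new, d⟩ :: m :: S) v = run σ (m :: S) v := fun v hv =>
    run_insert_eq hne.1 hv
  have hrun2 : ∀ v ≠ x, run (run σ (⟨x, m.new, d⟩ :: m :: S)) (m₂ :: R') v =
      run (run σ (m :: S)) (m₂ :: R') v := by
    intro v hv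
    have := run_restrict (t := {x}ᶜ) (L := m₂ :: R') hrun hv
    rwa [restrict_eq_self hne.2] at this
  refine ⟨?_, hmem.2, hval.2.congr hmem.2 ?_, ?_, ?_, ?_, ?_⟩
  · rw [hm₂]
    exact (run_of_not_mem hne.1).trans (by simp)
  · rintro v (rfl | rfl)
    exacts [hrun _ hxp.ne.symm, hrun _ hxw.ne.symm]
  · rw [hrun _ hxp.ne.symm, hrun _ hxw.ne.symm]
    exact hval.1.run_ne (by simp) (by simp) hpw h.ne
  · rwa [hrun2 _ hxp.ne.symm]
  · rwa [hrun2 _ hxw.ne.symm]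
  · rw [hm₂]
    exact lastOld_segment_ne hmem.1 hval.1 hd hS

/-- If `x` can take a color that never occurs afterwards, then two moves of `x` suffice. -/
lemma IsHit.extends_of_avoid (hxp : G.Adj x p) (hxw : G.Adj x w) (hpw : G.Adj p w)
    (h : IsHit G p w x b σ o m R) (hd : d ≠ σ p ∧ d ≠ σ w ∧ d ≠ m.new)
    (hR : ∀ m' ∈ R, m'.new ≠ d) : Extends G p w x b 14 3 σ o (m :: R) := by
  have hne := h.ne_of_mem hxp hxw
  have hval := validOn_segment (S := []) h.color (by simpa using h.mem m (by simp)) hxp hxw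
    ((validOn_append (L := [m])).1 h.valid).1 hd (by simp)
  have hval2 := ((validOn_append (L := [m])).1 h.valid).2
  simp only [List.forall_mem_cons] at hne
  have hmem := h.mem
  simp only [List.forall_mem_cons] at hmem
  have hrun : ∀ v ≠ x, run σ [⟨x, m.new, d⟩, m] v = run σ [m] v := fun v hv =>
    run_insert_eq (by simpa using hne.1) hv
  have hrun2 : ∀ v ≠ x, run (run σ [⟨x, m.new, d⟩, m]) R v = run σ (m :: R) v := by
    intro v hv
    have := run_restrict (t := {x}ᶜ) (L := R) hrun hv
    rwa [restrict_eq_self hne.2] at this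
  have key : Extends G p w x b 7 2 (run σ [⟨x, m.new, d⟩, m]) (some m.old) R := by
    refine Recolor.extends_of_avoid hxp hxw hmem.2 (hval2.congr hmem.2 ?_) ?_ ?_ ?_
    · rintro v (rfl | rfl)
      exacts [hrun _ hxp.ne.symm, hrun _ hxw.ne.symm]
    · simpa [hne.1.symm] using hR
    · rw [hrun2 _ hxp.ne.symm]; exact h.left
    · rw [hrun2 _ hxw.ne.symm]; exact h.right
  refine key.prepend (M := [m]) ?_ hval ?_ ?_ ?_
  · rw [restrict_cons_not_mem (by simp)]
    exact restrict_eq_self (by simpa using hne.1)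
  · rcases hmem.1 with hm | (hm : m.vertex = w) <;>
      simp [restrict, count, useful, hm, hxp.ne, hxw.ne, hpw.ne, hpw.ne.symm,
        hxp.ne.symm, hxw.ne.symm]
  · rcases hmem.1 with hm | (hm : m.vertex = w) <;>
      simp [restrict, count, useful, hm, hxp.ne, hxw.ne, hpw.ne, hpw.ne.symm,
        hxp.ne.symm, hxw.ne.symm]
  · have : count x [⟨x, m.new, d⟩, m] = 1 := by simp [count, restrict, hne.1]
    rw [this]
    simp only [List.cons_append, List.nil_append, useful, if_neg h.prev]
    omega

lemma IsHit.extends_of_isTight {m₂ m₃ : Move V} {S₂ : List (Move V)} {f g : Fin 5}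
    (hxp : G.Adj x p) (hxw : G.Adj x w) (hpw : G.Adj p w)
    (h : IsHit G p w x b σ o m (S ++ m₂ :: (S₂ ++ m₃ :: R)))
    (hd : d ≠ σ p ∧ d ≠ σ w ∧ d ≠ m.new) (he : e ≠ σ p ∧ e ≠ σ w ∧ e ≠ m.new) (hde : d ≠ e)
    (hm₂ : m₂.new = d) (hSe : ∃ m' ∈ S, m'.new = e) (ht : IsTight p w m S)
    (hg : g ≠ run σ (⟨x, m.new, d⟩ :: m :: S) p ∧ g ≠ run σ (⟨x, m.new, d⟩ :: m :: S) w ∧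
      g ≠ m₂.new)
    (hf : f ≠ run σ (⟨x, m.new, d⟩ :: m :: S) p ∧ f ≠ run σ (⟨x, m.new, d⟩ :: m :: S) w ∧
      f ≠ m₂.new) (hgf : g ≠ f) (hSf : ∃ m' ∈ S₂, m'.new = f) (ht₂ : IsTight p w m₂ S₂)
    (key : Extends G p w x b C D (run (run σ (⟨x, m.new, d⟩ :: m :: S))
      (⟨x, m₂.new, g⟩ :: m₂ :: S₂)) (lastOld (lastOld o (m :: S)) (m₂ :: S₂)) (m₃ :: R)) :
    Extends G p w x b C D σ o (m :: (S ++ m₂ :: (S₂ ++ m₃ :: R))) := by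
  obtain ⟨hm, y, rfl, hy⟩ := ht
  obtain ⟨hm2, y₂, rfl, hy₂⟩ := ht₂
  obtain ⟨v1, old1, c⟩ := m
  obtain ⟨v2, old2, e'⟩ := y
  obtain ⟨v3, old3, d'⟩ := m₂
  obtain ⟨v4, old4, f'⟩ := y₂
  simp only at hm hy hm2 hy₂ hm₂ hd he
  simp only [List.mem_singleton, exists_eq_left] at hSe hSf
  subst hm hy hm2 hy₂ hm₂ hSe hSf
  have hadj := hxp.ne
  have hadj2 := hxw.ne
  have hadj3 := hpw.ne
  obtain ⟨ho1, hn1, hc1, ho2, hn2, hc2, ho3, hn3, hc3, ho4, hn4, hc4, -⟩ := h.valid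
  have hcw := hc1 v4 (by simp) hpw
  have hab := h.ne
  have hx := h.color
  have ho := h.prev
  replace hcw : σ v4 ≠ c := hcw
  replace hx : σ x = c := hx
  replace ho : o ≠ some c := ho
  replace ho1 : σ v3 = old1 := ho1
  replace ho2 : σ v4 = old2 := by simpa [hpw.ne.symm] using ho2
  replace ho3 : c = old3 := by simpa [hpw.ne] using ho3
  replace ho4 : e' = old4 := by simpa [hpw.ne.symm] using ho4
  replace hn1 : c ≠ old1 := hn1
  subst ho1 ho2 ho3 ho4
  simp [hpw.ne] at hg hf
  rw [← run_append] at key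
  have colors := eq_or_eq_of_five_colors (σ v3) (σ v4) c d' e'
    (by simp; exact ⟨⟨hab, hn1.symm, hd.1.symm, he.1.symm⟩, ⟨hcw, hd.2.1.symm, he.2.1.symm⟩,
      ⟨hd.2.2.symm, he.2.2.symm⟩, hde⟩)
  have cg := colors g hg.1 hg.2.1 hg.2.2
  have cf := colors f' hf.1 hf.2.1 hf.2.2
  exact extends_of_tight hxp hxw hpw.ne rfl rfl hx hab hn1.symm hcw hd he hde
    (by grind) ho key

/-- From a hit on, the moves of `p` and `w` can be completed with few moves of `x`. -/
lemma IsHit.extends (hxp : G.Adj x p) (hxw : G.Adj x w) (hpw : G.Adj p w)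
    (h : IsHit G p w x b σ o m R) : Extends G p w x b 15 3 σ o (m :: R) := by
  induction hn : R.length using Nat.strong_induction_on generalizing σ o m R with
  | _ n ih =>
  subst hn
  obtain ⟨d, e, hd, he, hde, hR | ⟨S, m₂, R, rfl, hm₂, hS, hSe⟩⟩ :=
    exists_late_color (σ p) (σ w) m.new R
  · exact (h.extends_of_avoid hxp hxw hpw hd hR).mono (by omega) le_rfl
  have h₂ := h.next hxp hxw hpw hd hS hm₂
  have hne := h.ne_of_mem hxp hxw
  have hmem := h.mem
  have hval := h.valid
  rw [← List.cons_append, List.forall_mem_append] at hmem hne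
  rw [← List.cons_append, validOn_append] at hval
  have hval₁ := validOn_segment h.color hmem.1 hxp hxw hval.1 hd hS
  have hu := useful_segment hmem.1 hval.1 h.prev he hSe
  have hS0 : S ≠ [] := by rintro rfl; simp at hSe
  have hmem' := List.forall_mem_cons.1 hmem.1
  obtain ⟨c₁, c₁'⟩ := segment_cost (d := d) hxp hxw hpw.ne hmem'.1 hmem'.2 hS0
  obtain ⟨c₂, c₂'⟩ := segment_cost (p := w) (w := p) (d := d) hxw hxp hpw.ne.symm
    (by rw [Set.pair_comm]; exact hmem'.1) (by rw [Set.pair_comm]; exact hmem'.2) hS0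
  have hr : restrict {x}ᶜ (⟨x, m.new, d⟩ :: m :: S) = m :: S := by
    rw [restrict_cons_not_mem (by simp)]
    exact restrict_eq_self hne.1
  have cx := count_segment (d := d) hxp hxw hmem'.1 hmem'.2
  set σ₂ := run σ (⟨x, m.new, d⟩ :: m :: S) with hσ₂
  unfold Cheap at c₁ c₂
  obtain ⟨g, f, hg, hf, hgf, hR₂ | ⟨S₂, m₃, R, rfl, hm₃, hS₂, hS₂f⟩⟩ :=
    exists_late_color (σ₂ p) (σ₂ w) m₂.new R
  · rw [← List.cons_append]
    refine (h₂.extends_of_avoid hxp hxw hpw hg hR₂).prepend hr hval₁ ?_ ?_ ?_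
    · omega
    · omega
    · rw [useful_append]; omega
  have h₃ := h₂.next hxp hxw hpw hg hS₂ hm₃
  have hne₂ := h₂.ne_of_mem hxp hxw
  have hmem₂ := h₂.mem
  have hvalt := h₂.valid
  rw [← List.cons_append, List.forall_mem_append] at hmem₂ hne₂
  rw [← List.cons_append, validOn_append] at hvalt
  have hval₂ := validOn_segment h₂.color hmem₂.1 hxp hxw hvalt.1 hg hS₂
  have hu₂ := useful_segment hmem₂.1 hvalt.1 h₂.prev hf hS₂f
  have hS₂0 : S₂ ≠ [] := by rintro rfl; simp at hS₂f
  have hmem₂' := List.forall_mem_cons.1 hmem₂.1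
  obtain ⟨k₁, k₁'⟩ := segment_cost (d := g) hxp hxw hpw.ne hmem₂'.1 hmem₂'.2 hS₂0
  obtain ⟨k₂, k₂'⟩ := segment_cost (p := w) (w := p) (d := g) hxw hxp hpw.ne.symm
    (by rw [Set.pair_comm]; exact hmem₂'.1) (by rw [Set.pair_comm]; exact hmem₂'.2) hS₂0
  have hr₂ : restrict {x}ᶜ (⟨x, m₂.new, g⟩ :: m₂ :: S₂) = m₂ :: S₂ := by
    rw [restrict_cons_not_mem (by simp)]
    exact restrict_eq_self hne₂.1
  have cx₂ := count_segment (d := g) hxp hxw hmem₂'.1 hmem₂'.2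
  unfold Cheap at k₁ k₂
  have key := ih R.length (by simp; omega) h₃ rfl
  by_cases ht : IsTight p w m S ∧ IsTight p w m₂ S₂
  · exact h.extends_of_isTight hxp hxw hpw hd he hde hm₂ hSe ht.1 hg hf hgf hS₂f ht.2 key
  by_cases ht' : IsTight w p m S ∧ IsTight w p m₂ S₂
  · exact (h.symm.extends_of_isTight hxw hxp hpw.symm ⟨hd.2.1, hd.1, hd.2.2⟩
      ⟨he.2.1, he.1, he.2.2⟩ hde hm₂ hSe ht'.1 ⟨hg.2.1, hg.1, hg.2.2⟩
      ⟨hf.2.1, hf.1, hf.2.2⟩ hgf hS₂f ht'.2 key.symm).symm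
  rw [show m :: (S ++ m₂ :: (S₂ ++ m₃ :: R)) = (m :: S ++ m₂ :: S₂) ++ m₃ :: R by simp]
  rw [hσ₂, ← run_append] at key
  have a₁ := useful_none_append_le (restrict {w, x} (⟨x, m.new, d⟩ :: m :: S))
    (restrict {w, x} (⟨x, m₂.new, g⟩ :: m₂ :: S₂))
  have a₂ := useful_none_append_le (restrict {p, x} (⟨x, m.new, d⟩ :: m :: S))
    (restrict {p, x} (⟨x, m₂.new, g⟩ :: m₂ :: S₂))
  rw [← restrict_append] at a₁ a₂
  refine key.prepend ?_ (validOn_append.2 ⟨hval₁, hval₂⟩) ?_ ?_ ?_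
  · rw [restrict_append, hr, hr₂]
  · simp only [count_append]
    rw [not_and_or] at ht
    rcases ht with ht | ht
    · have := c₁' ht; omega
    · have := k₁' ht; omega
  · simp only [count_append]
    rw [not_and_or] at ht'
    rcases ht' with ht | ht
    · have := c₂' ht; omega
    · have := k₂' ht; omega
  · rw [useful_append, useful_append, lastOld_append, count_append]
    omega

lemma exists_extends_of_triangle (hxp : G.Adj x p) (hxw : G.Adj x w) (hpw : G.Adj p w)
    (hM : ∀ m ∈ M, m.vertex ∈ ({p, w} : Set V)) (h : ValidOn G {p, w} σ M) (h₁ : σ x ≠ σ p)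
    (h₂ : σ x ≠ σ w) (h₃ : σ p ≠ σ w) (hbp : run σ M p ≠ b) (hbw : run σ M w ≠ b) :
    Extends G p w x b 15 3 σ none M := by
  by_cases hmem : ∃ m ∈ M, m.new = σ x
  · obtain ⟨S, m, R, rfl, hm, hS⟩ := exists_first hmem
    rw [List.forall_mem_append] at hM
    obtain ⟨hv₁, hv₂⟩ := validOn_append.1 h
    have hSx : ∀ m ∈ S, m.vertex ≠ x := by
      intro m hm hmx
      have := hM.1 m hm
      simp [hmx, hxp.ne, hxw.ne] at this
    have hlast : lastOld none S ≠ some (σ x) := lastOld_ne (by simp) (hv₁.old_ne hM.1 (by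
      rintro v (rfl | rfl)
      exacts [h₁.symm, h₂.symm]) hS)
    have hit : IsHit G p w x b (run σ S) (lastOld none S) m R :=
      ⟨by rw [run_of_not_mem hSx, hm], hM.2, hv₂, hv₁.run_ne (by simp) (by simp) hpw h₃,
        by rwa [← run_append], by rwa [← run_append], by rwa [hm]⟩
    have u₁ := useful_pair_le (w := w) hSx none
    have u₂ := useful_pair_le (w := p) hSx none
    have c₀ := count_eq_zero hSx
    refine (hit.extends hxp hxw hpw).prepend (restrict_eq_self (by simpa using hSx))
      (hv₁.insert hSx hS) (by omega) (by omega) ?_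
    rw [useful_append]
    omega
  · push Not at hmem
    exact (extends_of_avoid hxp hxw hM h hmem hbp hbw).mono (by omega) (by omega)

end Triangle

section Extension

variable {G : SimpleGraph V} {p w x : V} {σ α β : V → Fin 5} {s N : Set V}
  {L M : List (Move V)} {b : Fin 5} {h : ℕ}

/-- Moves of a single neighbor `p` of `x` can be completed with few moves of `x`. -/
lemma exists_completion_of_edge (hxp : G.Adj x p) (hM : ∀ m ∈ M, m.vertex = p)
    (hv : ValidOn G {p} σ M) (hσ : σ x ≠ σ p) (hb : run σ M p ≠ b) :
    ∃ L, restrict {x}ᶜ L = M ∧ ValidOn G {x, p} σ L ∧ run σ L x = b ∧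
      2 * count x L ≤ M.length + 3 ∧
      ((∀ m ∈ M.head?, m.new ≠ σ x) → 2 * count x L ≤ M.length + 2) := by
  induction M generalizing σ with
  | nil =>
    by_cases hxb : σ x = b
    · exact ⟨[], rfl, trivial, hxb, by simp [count], by simp [count]⟩
    · refine ⟨[⟨x, σ x, b⟩], by simp [restrict], ⟨rfl, Ne.symm hxb, ?_, trivial⟩, by simp,
        by simp [count, restrict], by simp [count, restrict]⟩
      rintro u (rfl | rfl) hadj
      · exact absurd hadj G.irrefl
      · exact hb
  | cons m M ih =>
    simp only [List.forall_mem_cons] at hM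
    obtain ⟨hm, hM⟩ := hM
    subst hm
    obtain ⟨h1, h2, -, h4⟩ := hv
    by_cases hit : m.new = σ x
    · have key : ∀ a b c : Fin 5, ∃ d, d ≠ a ∧ d ≠ b ∧ d ≠ c := by decide
      obtain ⟨d, hd1, hd2, hd3⟩ := key m.old m.new ((M.head?.map Move.new).getD 0)
      obtain ⟨L, l1, l2, l3, -, l5⟩ := ih (σ := update (update σ x d) m.vertex m.new) hM
        (h4.congr (by simpa using hM) (by simp))
        (by simp [hxp.ne, hd2])
        (by
          have := run_restrict (σ := update σ m.vertex m.new) (L := M) (t := {m.vertex})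
            (τ := update (update σ x d) m.vertex m.new) (v := m.vertex) (by simp) (by simp)
          rw [restrict_eq_self (by simpa using hM)] at this
          rw [this]
          exact hb)
      have hcount := l5 (by
        intro m' hm'
        rw [Option.mem_def.1 hm'] at hd3
        simpa [hxp.ne] using hd3.symm)
      have hc : count x (⟨x, σ x, d⟩ :: m :: L) = 1 + count x L := by
        rw [count_cons_self (by rfl), count_cons_of_ne hxp.ne.symm, add_comm]
      refine ⟨⟨x, σ x, d⟩ :: m :: L, ?_, ⟨rfl, hit ▸ hd2, ?_, ?_, h2, ?_, l2⟩, l3, ?_, ?_⟩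
      · rw [restrict_cons_not_mem (by simp), restrict_cons_mem (by simpa using hxp.ne.symm), l1]
      · rintro u (rfl | rfl) hadj
        · exact absurd hadj G.irrefl
        · rw [h1]; exact hd1.symm
      · simp [hxp.ne.symm, h1]
      · rintro u (rfl | rfl) hadj
        · simpa using hd2
        · exact absurd hadj G.irrefl
      · rw [hc]; simp only [List.length_cons]; omega
      · intro hne
        exact absurd hit (hne m (by simp))
    · obtain ⟨L, l1, l2, l3, l4, -⟩ := ih hM h4 (by simpa [hxp.ne] using Ne.symm hit) hb
      have hc : count x (m :: L) = count x L := count_cons_of_ne hxp.ne.symm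
      refine ⟨m :: L, ?_, ⟨h1, h2, ?_, l2⟩, l3, ?_, fun _ => ?_⟩
      · rw [restrict_cons_mem (by simpa using hxp.ne.symm), l1]
      · rintro u (rfl | rfl) hadj
        · exact Ne.symm hit
        · exact absurd hadj G.irrefl
      · rw [hc]; simp only [List.length_cons]; omega
      · rw [hc]; simp only [List.length_cons]; omega

/-- The moves `L` recolor the vertices of `s` from `α` to `β`, each at most `h` times, and each
edge of `G` in `s` has at most `2 * h - 2` useful moves. -/
structure IsPlan (G : SimpleGraph V) (h : ℕ) (α β : V → Fin 5) (s : Set V) (L : List (Move V)) :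
    Prop where
  mem : ∀ m ∈ L, m.vertex ∈ s
  valid : ValidOn G s α L
  run_eq : ∀ v ∈ s, run α L v = β v
  count_le : ∀ v ∈ s, count v L ≤ h
  useful_le : ∀ u ∈ s, ∀ v ∈ s, G.Adj u v → useful none (restrict {u, v} L) ≤ 2 * h - 2

lemma IsPlan.exists_insert (hL : IsPlan G h α β s L) (hx : x ∉ s) (hNs : N ⊆ s)
    (hN : ∀ v ∈ s, G.Adj x v → v ∈ N) (hM : restrict {x}ᶜ M = restrict N L)
    (hv : ValidOn G (insert x N) α M) (hrun : run α M x = β x) (hcount : count x M ≤ h)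
    (huse : ∀ v ∈ N, useful none (restrict {v, x} M) ≤ 2 * h - 2)
    (hmem : ∀ m ∈ M, m.vertex ∈ insert x N) :
    ∃ K, IsPlan G h α β (insert x s) K ∧ restrict s K = L := by
  have hLx : ∀ m ∈ L, m.vertex ≠ x := fun m hm hmx => hx (hmx ▸ hL.mem m hm)
  have hagree : restrict (insert x N) L = restrict s M := by
    rw [restrict_congr (t := N) (by simpa using fun m hm hmx => absurd hmx (hLx m hm)), ← hM]
    refine restrict_congr fun m hm => ?_
    rcases hmem m hm with hmx | hmN
    · simp [hmx, hx]
    · simp only [hNs hmN, iff_true]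
      exact fun hmx => hx (hmx ▸ hNs hmN)
  obtain ⟨K, hKs, hKt, hK⟩ := exists_shuffle hL.mem hmem hagree
  have hunion : s ∪ insert x N = insert x s := by
    rw [Set.union_insert, Set.union_eq_self_of_subset_right hNs]
  have hpair : ∀ {r t : Set V}, r ⊆ t → restrict r (restrict t K) = restrict r K :=
    fun hrt => restrict_restrict hrt K
  have hxt : ∀ v ∈ N, useful none (restrict {v, x} K) ≤ 2 * h - 2 := by
    intro v hv
    rw [← hpair (r := {v, x}) (t := insert x N), hKt]
    · exact huse v hv
    · rintro u (rfl | rfl)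
      exacts [Or.inr hv, Or.inl rfl]
  refine ⟨K, ⟨hunion ▸ hK, ?_, ?_, ?_, ?_⟩, hKs⟩
  · rw [← hunion]
    refine validOn_union (σ₁ := α) (σ₂ := α) (hKs ▸ hL.valid) (hKt ▸ hv) (fun _ _ => rfl)
      (fun _ _ => rfl) hK ?_
    rw [hunion]
    rintro u (rfl | hu) v (rfl | hv) huv
    · exact Or.inr ⟨Or.inl rfl, Or.inl rfl⟩
    · exact Or.inr ⟨Or.inl rfl, Or.inr (hN v hv huv)⟩
    · exact Or.inr ⟨Or.inr (hN u hu huv.symm), Or.inl rfl⟩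
    · exact Or.inl ⟨hu, hv⟩
  · rintro v (rfl | hv)
    · rw [← hrun, ← hKt]
      exact (run_restrict (t := insert v N) (fun _ _ => rfl) (by simp)).symm
    · rw [← hL.run_eq v hv, ← hKs]
      exact (run_restrict (fun _ _ => rfl) hv).symm
  · rintro v (rfl | hv)
    · rwa [← count_restrict (s := insert v N) (by simp), hKt]
    · rw [← count_restrict hv, hKs]
      exact hL.count_le v hv
  · rintro u (rfl | hu) v (rfl | hv) huv
    · exact absurd huv G.irrefl
    · rw [Set.pair_comm]
      exact hxt v (hN v hv huv)
    · exact hxt u (hN u hu huv.symm)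
    · rw [← hpair (r := {u, v}) (t := s), hKs]
      · exact hL.useful_le u hu v hv huv
      · rintro y (rfl | rfl)
        exacts [hu, hv]

lemma length_restrict_pair (hpx : p ≠ x) (L : List (Move V)) :
    (restrict {p, x} L).length = count p L + count x L := by
  induction L with
  | nil => rfl
  | cons m L ih =>
    by_cases hp : m.vertex = p
    · rw [restrict_cons_mem (by simp [hp]), count_cons_self hp, count_cons_of_ne (by rwa [hp]),
        List.length_cons, ih]
      omega
    · by_cases hx : m.vertex = x
      · rw [restrict_cons_mem (by simp [hx]), count_cons_self hx, count_cons_of_ne hp,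
          List.length_cons, ih]
        omega
      · rw [restrict_cons_not_mem (by simp [hp, hx]), count_cons_of_ne hx, count_cons_of_ne hp, ih]

lemma exists_mem_of_restrict_compl (hM : restrict {x}ᶜ M = L) (hL : ∀ m ∈ L, m.vertex ∈ N) :
    ∀ m ∈ M, m.vertex ∈ insert x N := by
  intro m hm
  by_cases hmx : m.vertex = x
  · exact Or.inl hmx
  · exact Or.inr (hL m (hM ▸ by simpa [restrict, hmx] using hm))

lemma mem_of_mem_restrict {m : Move V} (hm : m ∈ restrict s L) : m.vertex ∈ s := by
  simpa [restrict] using (List.mem_filter.1 hm).2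

/-- A plan can be extended to a new vertex whose neighbors form a clique of size at most `2`. -/
lemma IsPlan.exists_insert_of_clique (hh : 26 ≤ h) (hα : IsProperColoring G α)
    (hβ : IsProperColoring G β) (hL : IsPlan G h α β s L) (hx : x ∉ s) (hNs : N ⊆ s)
    (hN : ∀ v ∈ s, G.Adj x v → v ∈ N) (hxN : ∀ v ∈ N, G.Adj x v)
    (hclique : N = ∅ ∨ (∃ p, N = {p}) ∨ ∃ p w, G.Adj p w ∧ N = {p, w}) :
    ∃ K, IsPlan G h α β (insert x s) K ∧ restrict s K = L := by
  have hv : ValidOn G N α (restrict N L) := hL.valid.restrict hNs fun _ _ => rfl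
  have hrun : ∀ v ∈ N, run α (restrict N L) v = β v := fun v hvN =>
    (run_restrict (fun _ _ => rfl) hvN).trans (hL.run_eq v (hNs hvN))
  have hc : ∀ {M}, restrict {x}ᶜ M = restrict N L → ∀ v ∈ N, count v M = count v L := by
    intro M hM v hvN
    rw [← count_restrict (s := {x}ᶜ) (hxN v hvN).ne.symm, hM, count_restrict hvN]
  have hmem : ∀ m ∈ restrict N L, m.vertex ∈ N := fun m hm => mem_of_mem_restrict hm
  rcases hclique with rfl | ⟨p, rfl⟩ | ⟨p, w, hpw, rfl⟩
  · have hnil : restrict ∅ L = [] := restrict_eq_nil (by simp)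
    by_cases hb : α x = β x
    · refine hL.exists_insert (M := []) hx hNs hN hnil.symm trivial hb (by simp [count]) (by simp)
        (by simp)
    · refine hL.exists_insert (M := [⟨x, α x, β x⟩]) hx hNs hN ?_ ⟨rfl, Ne.symm hb, ?_, trivial⟩
        (by simp) ?_ (by simp) (by simp)
      · rw [hnil, restrict_eq_nil (by simp)]
      · rintro u (rfl | hu) hadj
        exacts [absurd hadj G.irrefl, absurd hu (Set.notMem_empty u)]
      · simp [count, restrict]; omega
  · have hxp := hxN p rfl
    have hp := hL.count_le p (hNs rfl)
    obtain ⟨M, m1, m2, m3, m4, -⟩ := exists_completion_of_edge (b := β x) hxp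
      (fun m hm => hmem m hm) hv (hα hxp) (by rw [hrun p rfl]; exact hβ hxp.symm)
    have hcp := hc m1 p rfl
    have hlen : (restrict {p} L).length = count p L := rfl
    refine hL.exists_insert hx hNs hN m1 m2 m3 (by omega) ?_
      (exists_mem_of_restrict_compl m1 hmem)
    rintro v rfl
    have := length_restrict_pair hxp.ne.symm M
    have := useful_le_length none (restrict {v, x} M)
    omega
  · have hxp := hxN p (by simp)
    have hxw := hxN w (by simp)
    have hp := hL.count_le p (hNs (by simp))
    have hw := hL.count_le w (hNs (by simp))
    have hu := hL.useful_le p (hNs (by simp)) w (hNs (by simp)) hpw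
    obtain ⟨M, m1, m2, m3, m4, m5, m6⟩ := exists_extends_of_triangle (b := β x) hxp hxw hpw hmem hv
      (hα hxp) (hα hxw) (hα hpw) (by rw [hrun p (by simp)]; exact hβ hxp.symm)
      (by rw [hrun w (by simp)]; exact hβ hxw.symm)
    have hcp := hc m1 p (by simp)
    have hcw := hc m1 w (by simp)
    have hlp := length_restrict_pair hxp.ne.symm M
    have hlw := length_restrict_pair hxw.ne.symm M
    have up := useful_le_length none (restrict {p, x} M)
    have uw := useful_le_length none (restrict {w, x} M)
    unfold Cheap at m4 m5
    refine hL.exists_insert hx hNs hN m1 m2 m3 (by omega) ?_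
      (exists_mem_of_restrict_compl m1 hmem)
    rintro v (rfl | rfl)
    · omega
    · omega

/-- The plan recoloring `v` along the color sequence `cs`. -/
lemma exists_isPlan_singleton {q : ℕ} (v : V) (cs : Fin (q + 1) → Fin 5)
    (hcs : ∀ i : Fin q, cs i.castSucc ≠ cs i.succ) (hq : q ≤ h) (hα : α v = cs 0)
    (hβ : β v = cs (Fin.last q)) :
    ∃ L, IsPlan G h α β {v} L ∧ (restrict {v} L).map Move.new = List.ofFn fun i => cs i.succ := by
  have key : ∀ (q : ℕ) (α : V → Fin 5) (cs : Fin (q + 1) → Fin 5),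
      (∀ i : Fin q, cs i.castSucc ≠ cs i.succ) → α v = cs 0 →
      ∃ L, (∀ m ∈ L, m.vertex = v) ∧ ValidOn G {v} α L ∧ run α L v = cs (Fin.last q) ∧
        L.map Move.new = List.ofFn fun i => cs i.succ := by
    intro q
    induction q with
    | zero => exact fun α cs _ h0 => ⟨[], by simp, trivial, h0, by simp⟩
    | succ q ih =>
      intro α cs hcs h0
      obtain ⟨L, l1, l2, l3, l4⟩ := ih (update α v (cs 1)) (fun i => cs i.succ)
        (fun i => hcs i.succ) (by simp)
      refine ⟨⟨v, cs 0, cs 1⟩ :: L, by simpa using l1, ⟨h0, (hcs 0).symm, ?_, l2⟩, l3, ?_⟩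
      · rintro u rfl hadj
        exact absurd hadj G.irrefl
      · rw [List.ofFn_succ, List.map_cons, l4]
        rfl
  obtain ⟨L, l1, l2, l3, l4⟩ := key q α cs hcs hα
  have hL : restrict {v} L = L := restrict_eq_self l1
  refine ⟨L, ⟨l1, l2, ?_, ?_, ?_⟩, by rw [hL, l4]⟩
  · rintro u rfl
    rw [l3, hβ]
  · rintro u rfl
    have := congrArg List.length l4
    simp only [List.length_map, List.length_ofFn] at this
    rw [count, hL, this]
    exact hq
  · rintro u rfl u' rfl hadj
    exact absurd hadj G.irrefl

end Extension

section Chordal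

variable {G : SimpleGraph V}

lemma mem_edges_of_shortest {u v a b : V} (r₁ : G.Walk u a) (r : G.Walk a b) (r₂ : G.Walk b v)
    (h : r₁.length + (r.length + r₂.length) = G.dist u v) (hab : G.Adj a b) :
    s(a, b) ∈ r.edges := by
  have h₁ := SimpleGraph.dist_le (r₁.append (Walk.cons hab r₂))
  rw [Walk.length_append, Walk.length_cons] at h₁
  have h₂ : r.length ≤ 1 := by omega
  cases r with
  | nil => exact absurd hab G.irrefl
  | cons h r =>
    cases r with
    | nil => simp
    | cons h' r => simp at h₂

/-- A shortest walk has no chords. -/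
lemma mem_edges_of_length_eq_dist {u v : V} (p : G.Walk u v) (hp : p.length = G.dist u v) {a b : V}
    (ha : a ∈ p.support) (hb : b ∈ p.support) (hab : G.Adj a b) : s(a, b) ∈ p.edges := by
  have h₁ := p.take_spec ha
  rw [← h₁, Walk.mem_support_append_iff] at hb
  rcases hb with hb | hb
  · have h₂ := (p.takeUntil a ha).take_spec hb
    have := congrArg Walk.length h₁
    have := congrArg Walk.length h₂
    rw [Walk.length_append] at *
    have h := mem_edges_of_shortest ((p.takeUntil a ha).takeUntil b hb)
      ((p.takeUntil a ha).dropUntil b hb) (p.dropUntil a ha) (by omega) hab.symm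
    rw [Sym2.eq_swap]
    exact p.edges_takeUntil_subset_edges _ ((p.takeUntil a ha).edges_dropUntil_subset_edges _ h)
  · have h₂ := (p.dropUntil a ha).take_spec hb
    have := congrArg Walk.length h₁
    have := congrArg Walk.length h₂
    rw [Walk.length_append] at *
    have h := mem_edges_of_shortest (p.takeUntil a ha) ((p.dropUntil a ha).takeUntil b hb)
      ((p.dropUntil a ha).dropUntil b hb) (by omega) hab
    exact p.edges_dropUntil_subset_edges _ ((p.dropUntil a ha).edges_takeUntil_subset_edges _ h)

/-- The edges of `G` inside `s`. -/
def within (G : SimpleGraph V) (s : Set V) : SimpleGraph V where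
  Adj u v := G.Adj u v ∧ u ∈ s ∧ v ∈ s
  symm := ⟨fun _ _ h => ⟨h.1.symm, h.2.2, h.2.1⟩⟩
  loopless := ⟨fun _ h => G.irrefl h.1⟩

lemma within_le (G : SimpleGraph V) (s : Set V) : within G s ≤ G := fun _ _ h => h.1

lemma mem_of_mem_support {s : Set V} {u v : V} (hu : u ∈ s) (p : (within G s).Walk u v) :
    ∀ a ∈ p.support, a ∈ s := by
  induction p with
  | nil => simpa using hu
  | cons h p ih =>
    intro a ha
    rw [Walk.support_cons, List.mem_cons] at ha
    rcases ha with rfl | ha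
    exacts [hu, ih h.2.2 a ha]

/-- In a chordal graph, two neighbors of `v` joined by a path whose inner vertices lie outside the
closed neighborhood of `v` are equal or adjacent. -/
lemma eq_or_adj_of_reachable (hG : IsChordal G) {v s t : V} {D : Set V} (hs : G.Adj v s)
    (ht : G.Adj v t) (hD : ∀ a ∈ D, a ≠ v ∧ ¬ G.Adj v a)
    (hr : (within G (insert s (insert t D))).Reachable s t) : s = t ∨ G.Adj s t := by
  by_contra! hst
  obtain ⟨q, hq, hqd⟩ := hr.exists_path_of_dist
  have hE := mem_of_mem_support (Set.mem_insert _ _) q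
  have hvq : v ∉ q.support := by
    intro hv
    rcases hE v hv with h | h | h
    exacts [hs.ne h, ht.ne h, (hD _ h).1 rfl]
  let r := q.mapLe (within_le G _)
  have hrs : r.support = q.support := Walk.support_mapLe_eq_support _ _
  have hre : r.edges = q.edges := Walk.edges_mapLe_eq_edges _ _
  have hrl : 2 ≤ r.length := by
    by_contra! hlt
    cases hr : r with
    | nil => exact hst.1 rfl
    | cons h r' =>
      cases r' with
      | nil => exact hst.2 h
      | cons h' r' => rw [hr] at hlt; simp at hlt
  have hrp : r.IsPath := by
    rw [Walk.isPath_def, hrs]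
    exact hq.support_nodup
  have hcyc : (Walk.cons hs (r.concat ht.symm)).IsCycle := by
    rw [Walk.cons_isCycle_iff]
    refine ⟨hrp.concat (hrs ▸ hvq) _, ?_⟩
    rw [Walk.edges_concat]
    simp only [List.concat_eq_append, List.mem_append, List.mem_singleton, not_or]
    refine ⟨fun h => hvq (hrs ▸ r.fst_mem_support_of_mem_edges h), fun h => ?_⟩
    rw [Sym2.eq_swap, Sym2.congr_left] at h
    exact hst.1 h
  obtain ⟨a, b, ha, hb, hab, hnot⟩ := hG v _ hcyc (by simp; omega)
  simp only [Walk.edges_cons, Walk.edges_concat, List.mem_cons, List.concat_eq_append,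
    List.mem_append, not_or, List.not_mem_nil, or_false, Walk.support_cons,
    Walk.support_concat, hre, hrs] at hnot ha hb
  have key : ∀ c ∈ q.support, G.Adj v c → c = s ∨ c = t := by
    intro c hc hvc
    rcases hE c hc with h | h | h
    exacts [Or.inl h, Or.inr h, absurd hvc (hD _ h).2]
  by_cases hav : a = v
  · subst hav
    have hbq : b ∈ q.support := by
      have := hab.ne.symm
      tauto
    rcases key b hbq hab with rfl | rfl
    · exact hnot.1 rfl
    · exact hnot.2.2 Sym2.eq_swap
  by_cases hbv : b = v
  · subst hbv
    rcases key a (by tauto) hab.symm with rfl | rfl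
    · exact hnot.1 Sym2.eq_swap
    · exact hnot.2.2 rfl
  have haq : a ∈ q.support := by tauto
  have hbq : b ∈ q.support := by tauto
  exact hnot.2.1 (mem_edges_of_length_eq_dist q hqd haq hbq ⟨hab, hE a haq, hE b hbq⟩)

/-- The neighbors of `y` in `A` form a clique. -/
def IsSimplicial (G : SimpleGraph V) (A : Finset V) (y : V) : Prop :=
  ∀ s ∈ A, ∀ t ∈ A, G.Adj y s → G.Adj y t → s = t ∨ G.Adj s t

lemma exists_isSimplicial_not_adj (hG : IsChordal G) (A : Finset V) {v u : V} (hv : v ∈ A)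
    (hu : u ∈ A) (huv : u ≠ v) (hadj : ¬ G.Adj v u) :
    ∃ y ∈ A, y ≠ v ∧ ¬ G.Adj v y ∧ IsSimplicial G A y := by
  induction hn : A.card using Nat.strong_induction_on generalizing A v u with
  | _ n ih =>
  subst hn
  let D : Set V := {a | a ∈ A ∧ a ≠ v ∧ ¬ G.Adj v a}
  let C : Set V := {c | c ∈ D ∧ (within G D).Reachable u c}
  let S : Set V := {s | s ∈ A ∧ G.Adj v s ∧ ∃ c ∈ C, G.Adj c s}
  have huD : u ∈ D := ⟨hu, huv, hadj⟩
  have huC : u ∈ C := ⟨huD, Reachable.refl u⟩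
  have hCS : ∀ c ∈ C, ∀ b ∈ A, G.Adj c b → b ∈ C ∪ S := by
    intro c hc b hb hcb
    by_cases hvb : G.Adj v b
    · exact Or.inr ⟨hb, hvb, c, hc, hcb⟩
    · have hbD : b ∈ D := ⟨hb, fun h => hc.1.2.2 (h ▸ hcb.symm), hvb⟩
      have hcb' : (within G D).Adj c b := ⟨hcb, hc.1, hbD⟩
      exact Or.inl ⟨hbD, hc.2.trans hcb'.reachable⟩
  have hS : ∀ s ∈ S, ∀ t ∈ S, s = t ∨ G.Adj s t := by
    rintro s ⟨-, hvs, c, hc, hcs⟩ t ⟨-, hvt, c', hc', hct⟩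
    refine eq_or_adj_of_reachable hG (D := D) hvs hvt (fun a ha => ha.2) ?_
    have hmono : within G D ≤ within G (insert s (insert t D)) := fun a b h =>
      ⟨h.1, Or.inr (Or.inr h.2.1), Or.inr (Or.inr h.2.2)⟩
    have h₁ : (within G (insert s (insert t D))).Adj s c :=
      ⟨hcs.symm, Or.inl rfl, Or.inr (Or.inr hc.1)⟩
    have h₂ : (within G (insert s (insert t D))).Adj c' t :=
      ⟨hct, Or.inr (Or.inr hc'.1), Or.inr (Or.inl rfl)⟩
    exact h₁.reachable.trans (((hc.2.symm.trans hc'.2).mono hmono).trans h₂.reachable)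
  let A' := A.filter (· ∈ C ∪ S)
  have hmem : ∀ {a}, a ∈ A' ↔ a ∈ A ∧ a ∈ C ∪ S := Finset.mem_filter
  have hlift : ∀ y ∈ C, IsSimplicial G A' y → y ∈ A ∧ y ≠ v ∧ ¬ G.Adj v y ∧ IsSimplicial G A y :=
    fun y hy hsim => ⟨hy.1.1, hy.1.2.1, hy.1.2.2, fun s hs t ht hys hyt =>
      hsim s (hmem.2 ⟨hs, hCS y hy s hs hys⟩) t (hmem.2 ⟨ht, hCS y hy t ht hyt⟩) hys hyt⟩
  have hlt : A'.card < A.card := by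
    refine Finset.card_lt_card (Finset.filter_ssubset.2 ⟨v, hv, ?_⟩)
    rintro (h | h)
    exacts [h.1.2.1 rfl, G.irrefl h.2.1]
  by_cases hcomplete : ∀ x₁ ∈ A', ∀ x₂ ∈ A', x₁ = x₂ ∨ G.Adj x₁ x₂
  · exact ⟨u, hlift u huC fun s hs t ht _ _ => hcomplete s hs t ht⟩
  · push Not at hcomplete
    obtain ⟨x₁, hx₁, x₂, hx₂, hne, hnadj⟩ := hcomplete
    obtain ⟨y, hy, hyx, hyadj, hsim⟩ := ih _ hlt A' hx₁ hx₂ hne.symm hnadj rfl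
    rcases (hmem.1 hy).2 with hyC | hyS
    · exact ⟨y, hlift y hyC hsim⟩
    · obtain ⟨z, hz, hzy, hzadj, hsim'⟩ :=
        ih _ hlt A' hy hx₁ hyx.symm (fun h => hyadj h.symm) rfl
      rcases (hmem.1 hz).2 with hzC | hzS
      · exact ⟨z, hlift z hzC hsim'⟩
      · rcases hS y hyS z hzS with h | h
        exacts [absurd h.symm hzy, absurd h hzadj]

lemma exists_isSimplicial_ne (hG : IsChordal G) (A : Finset V) {v : V} (hv : v ∈ A)
    (hA : ∃ u ∈ A, u ≠ v) : ∃ y ∈ A, y ≠ v ∧ IsSimplicial G A y := by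
  by_cases h : ∃ u ∈ A, u ≠ v ∧ ¬ G.Adj v u
  · obtain ⟨u, hu, huv, hadj⟩ := h
    obtain ⟨y, hy, hyv, -, hsim⟩ := exists_isSimplicial_not_adj hG A hv hu huv hadj
    exact ⟨y, hy, hyv, hsim⟩
  push Not at h
  have hlift : ∀ y, IsSimplicial G (A.erase v) y → IsSimplicial G A y := by
    intro y hsim s hs t ht hys hyt
    by_cases hsv : s = v
    · by_cases htv : t = v
      · exact Or.inl (hsv.trans htv.symm)
      · exact Or.inr (hsv ▸ h t ht htv)
    · by_cases htv : t = v
      · exact Or.inr (htv ▸ (h s hs hsv).symm)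
      · exact hsim s (Finset.mem_erase.2 ⟨hsv, hs⟩) t (Finset.mem_erase.2 ⟨htv, ht⟩) hys hyt
  by_cases hcomplete : ∀ x₁ ∈ A.erase v, ∀ x₂ ∈ A.erase v, x₁ = x₂ ∨ G.Adj x₁ x₂
  · obtain ⟨u, hu, huv⟩ := hA
    exact ⟨u, hu, huv, hlift u fun s hs t ht _ _ => hcomplete s hs t ht⟩
  · push Not at hcomplete
    obtain ⟨x₁, hx₁, x₂, hx₂, hne, hnadj⟩ := hcomplete
    obtain ⟨y, hy, -, -, hsim⟩ := exists_isSimplicial_not_adj hG _ hx₁ hx₂ hne.symm hnadj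
    exact ⟨y, Finset.mem_of_mem_erase hy, Finset.ne_of_mem_erase hy, hlift y hsim⟩

lemma isMinor_top_of_injective {W : Type} (f : W → V) (hf : Injective f)
    (hadj : ∀ i j, i ≠ j → G.Adj (f i) (f j)) : IsMinor (⊤ : SimpleGraph W) G := by
  refine ⟨fun i => {f i}, fun i => Set.singleton_nonempty _, fun i j hij => ?_, fun i => ?_,
    fun i j hij => ⟨f i, rfl, f j, rfl, hadj i j hij.ne⟩⟩
  · exact Set.disjoint_singleton.2 (hf.ne hij)
  · rw [induce_singleton_eq_top]
    exact connected_top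

lemma IsSimplicial.card_neighbors_le (h4 : ¬ IsMinor (⊤ : SimpleGraph (Fin 4)) G) {A : Finset V}
    {x : V} (hx : IsSimplicial G A x) : (A.filter (G.Adj x)).card ≤ 2 := by
  by_contra! hlt
  obtain ⟨a, b, c, ha, hb, hc, hab, hac, hbc⟩ := Finset.two_lt_card_iff.1 hlt
  rw [Finset.mem_filter] at ha hb hc
  have h₁ := (hx a ha.1 b hb.1 ha.2 hb.2).resolve_left hab
  have h₂ := (hx a ha.1 c hc.1 ha.2 hc.2).resolve_left hac
  have h₃ := (hx b hb.1 c hc.1 hb.2 hc.2).resolve_left hbc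
  have hadj : ∀ i j : Fin 4, i ≠ j → G.Adj (![x, a, b, c] i) (![x, a, b, c] j) := by
    intro i j hij
    fin_cases i <;> fin_cases j <;>
      first
        | exact absurd rfl hij
        | simp [ha.2, hb.2, hc.2, h₁, h₂, h₃, ha.2.symm, hb.2.symm, hc.2.symm, h₁.symm, h₂.symm,
            h₃.symm]
  exact h4 (isMinor_top_of_injective _ (fun i j hij => by_contra fun h => (hadj i j h).ne hij) hadj)

end Chordal

section Conversion

variable {G : SimpleGraph V} {α β : V → Fin 5} {h : ℕ}

lemma exists_isPlan (hh : 26 ≤ h) (hG : IsChordal G) (h4 : ¬ IsMinor (⊤ : SimpleGraph (Fin 4)) G)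
    (hα : IsProperColoring G α) (hβ : IsProperColoring G β) {q : ℕ} (v : V)
    (cs : Fin (q + 1) → Fin 5) (hcs : ∀ i : Fin q, cs i.castSucc ≠ cs i.succ) (hq : q ≤ h)
    (hαv : α v = cs 0) (hβv : β v = cs (Fin.last q)) (A : Finset V) (hv : v ∈ A) :
    ∃ L, IsPlan G h α β A L ∧ (restrict {v} L).map Move.new = List.ofFn fun i => cs i.succ := by
  induction hn : A.card generalizing A with
  | zero => simp [Finset.card_eq_zero.1 hn] at hv
  | succ n ih =>
    by_cases hA : ∃ u ∈ A, u ≠ v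
    · obtain ⟨x, hx, hxv, hsim⟩ := exists_isSimplicial_ne hG A hv hA
      obtain ⟨L, hL, htrace⟩ := ih (A.erase x) (Finset.mem_erase.2 ⟨hxv.symm, hv⟩)
        (by rw [Finset.card_erase_of_mem hx]; omega)
      set N := A.filter (G.Adj x) with hN
      have hmem : ∀ {y}, y ∈ N ↔ y ∈ A ∧ G.Adj x y := Finset.mem_filter
      have hcard : N.card ≤ 2 := hsim.card_neighbors_le h4
      obtain ⟨K, hK, hKL⟩ := hL.exists_insert_of_clique (x := x) (N := (N : Set V)) hh hα hβ
        (by simp) (fun y hy => by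
          have := hmem.1 hy
          simpa using ⟨this.1, this.2.ne.symm⟩)
        (fun y hy hxy => hmem.2 ⟨Finset.mem_of_mem_erase hy, hxy⟩) (fun y hy => (hmem.1 hy).2) (by
          have hc : N.card = 0 ∨ N.card = 1 ∨ N.card = 2 := by omega
          rcases hc with hc | hc | hc
          · left
            simp [Finset.card_eq_zero.1 hc]
          · right; left
            obtain ⟨p, hp⟩ := Finset.card_eq_one.1 hc
            exact ⟨p, by simp [hp]⟩
          · right; right
            obtain ⟨p, w, hpw, hp⟩ := Finset.card_eq_two.1 hc
            have h₁ := hmem.1 (show p ∈ N by simp [hp])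
            have h₂ := hmem.1 (show w ∈ N by simp [hp])
            exact ⟨p, w, (hsim p h₁.1 w h₂.1 h₁.2 h₂.2).resolve_left hpw, by simp [hp]⟩)
      refine ⟨K, ?_, ?_⟩
      · rwa [← Finset.coe_insert, Finset.insert_erase hx] at hK
      · rw [← htrace, ← hKL, restrict_restrict]
        simpa using ⟨hv, hxv.symm⟩
    · push Not at hA
      have : (A : Set V) = {v} := by
        ext u
        exact ⟨fun hu => hA u hu, fun hu => by rw [Set.mem_singleton_iff.1 hu]; exact hv⟩
      rw [this]
      exact exists_isPlan_singleton v cs hcs hq hαv hβv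

lemma exists_isTransformSeq (hα : IsProperColoring G α) (L : List (Move V))
    (hL : ValidOn G Set.univ α L) :
    ∃ (m : ℕ) (c : Fin (m + 1) → V → Fin 5), IsTransformSeq G c α (run α L) ∧
      (∀ v, RecolorCount c v = count v L) ∧
      ∀ v, ColorTrace c v = α v :: (restrict {v} L).map Move.new := by
  induction L generalizing α with
  | nil =>
    refine ⟨0, fun _ => α, ⟨rfl, rfl, fun _ => hα, fun i => i.elim0⟩, fun v => rfl, fun v => ?_⟩
    simp [ColorTrace]
  | cons m L ih =>
    obtain ⟨h1, h2, h3, h4⟩ := hL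
    have hproper : IsProperColoring G (update α m.vertex m.new) := by
      intro u v huv
      by_cases hu : u = m.vertex
      · subst hu
        rw [update_self, update_of_ne huv.ne.symm]
        exact (h3 v trivial huv).symm
      · rw [update_of_ne hu]
        by_cases hv : v = m.vertex
        · subst hv
          rw [update_self]
          exact h3 u trivial huv.symm
        · rw [update_of_ne hv]
          exact hα huv
    obtain ⟨n, c, ⟨c1, c2, c3, c4⟩, c5, c6⟩ := ih hproper h4
    have hstep : ∀ v, α v ≠ c 0 v ↔ v = m.vertex := by
      intro v
      rw [c1]
      by_cases hv : v = m.vertex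
      · subst hv
        simpa [h1] using h2.symm
      · simp [hv]
    let c' : Fin (n + 1 + 1) → V → Fin 5 := Fin.cons α c
    have e0 : c' 0 = α := rfl
    have es : ∀ i : Fin (n + 1), c' i.succ = c i := fun i => Fin.cons_succ ..
    have ec : ∀ i : Fin n, c' i.succ.castSucc = c i.castSucc := fun i => by
      rw [← Fin.succ_castSucc, es]
    refine ⟨n + 1, c', ⟨rfl, ?_, ?_, ?_⟩, fun v => ?_, fun v => ?_⟩
    · rw [← Fin.succ_last, es, c2]
      rfl
    · intro i
      cases i using Fin.cases with
      | zero => exact hα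
      | succ i => rw [es]; exact c3 i
    · intro i
      cases i using Fin.cases with
      | zero =>
        refine ⟨m.vertex, ?_, fun v hv => ?_⟩
        · exact (hstep _).2 rfl
        · exact (hstep v).1 hv
      | succ i =>
        simp only [es, ec]
        exact c4 i
    · have hc := c5 v
      unfold RecolorCount at hc ⊢
      rw [Fin.card_filter_univ_succ]
      simp only [es, ec, Fin.castSucc_zero, e0, hstep]
      rw [hc]
      split_ifs with hv
      · rw [count_cons_self hv.symm]
      · rw [count_cons_of_ne (Ne.symm hv)]
    · have hc := c6 v
      unfold ColorTrace at hc ⊢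
      rw [List.ofFn_succ, List.destutter_cons'] at hc ⊢
      simp only [es, e0]
      rw [List.ofFn_succ]
      by_cases hv : v = m.vertex
      · rw [List.destutter'_cons_pos _ ((hstep v).2 hv), hc, restrict_cons_mem hv.symm, hv]
        simp
      · have heq : α v = c 0 v := not_not.1 (mt (hstep v).1 hv)
        rw [List.destutter'_cons_neg _ (not_not.2 heq), heq, hc,
          restrict_cons_not_mem (s := {v}) (fun hm => hv (Eq.symm hm)), c1]

end Conversion

end Recolor

end

theorem chordal_outerplanar_prescribed_order_recolor_five_colors
    {V : Type} [Fintype V] (H : SimpleGraph V) (hcard : 2 ≤ Fintype.card V)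
    (hch : IsChordal H)
    (h4 : ¬ IsMinor (⊤ : SimpleGraph (Fin 4)) H)
    (h23 : ¬ IsMinor (completeBipartiteGraph (Fin 2) (Fin 3)) H)
    (vn : V) (q : ℕ) (hq : q ≤ 690)
    (cs : Fin (q + 1) → Fin 5) (hcs : ∀ i : Fin q, cs i.castSucc ≠ cs i.succ)
    (α β : V → Fin 5)
    (hα : IsProperColoring H α) (hβ : IsProperColoring H β)
    (hαv : α vn = cs 0) (hβv : β vn = cs (Fin.last q)) :
    ∃ (m : ℕ) (c : Fin (m + 1) → V → Fin 5),
      IsTransformSeq H c α β ∧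
      (∀ v : V, RecolorCount c v ≤ 692) ∧
      ColorTrace c vn = List.ofFn cs := by
  obtain ⟨L, hL, htrace⟩ := Recolor.exists_isPlan (h := 692) (by norm_num) hch h4 hα hβ vn cs hcs
    (by omega) hαv hβv Finset.univ (Finset.mem_univ vn)
  rw [Finset.coe_univ] at hL
  obtain ⟨m, c, hc, hcount, hcolors⟩ := Recolor.exists_isTransformSeq hα L hL.valid
  have hrun : Recolor.run α L = β := funext fun v => hL.run_eq v trivial
  refine ⟨m, c, hrun ▸ hc, fun v => (hcount v).trans_le (hL.count_le v trivial), ?_⟩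
  rw [hcolors, htrace, hαv, List.ofFn_succ]
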